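/- Let L_v/K_v be a finite extension of nonarchimedean local fields where L_v has residue field of order Q and uniformizer of valuation 1/E in terms of the valuation of K_v normalized so v(p)=1 scaled appropriately; equivalently: the n-th diameter of the ring of integers O of a local field with residue field of order Q and absolute value of a uniformizer equal to q^{-1/e} satisfies: for n = Q^m, d_n(O) = (q^{-1/e})^{2·(Q^{m-1}-1)/(Q-1)·...}; in the limit, the transfinite diameter of O equals r^{1/(Q−1)} where r is the absolute value of a uniformizer of O. Concretely: lim_n d_n(O) = |π|^{1/(Q−1)} where π is a uniformizer of O and |·| the absolute value on O. -/

import Mathlib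

open Finset in
/-- A map from `n` points to a type with `N` elements has at least `n ^ 2 / N` ordered pairs of
points with equal image. -/
theorem sq_card_le_card_mul_card_filter_eq {ι α : Type*} [Fintype ι] [Fintype α] [DecidableEq α]
    (c : ι → α) :
    Fintype.card ι ^ 2 ≤
      Fintype.card α * #{p : ι × ι | c p.1 = c p.2} := by
  classical
  have h1 : Fintype.card ι = ∑ b : α, #{i | c i = b} :=
    Finset.card_eq_sum_card_fiberwise (s := univ) (t := univ) (by simp)
  have h2 : #{p : ι × ι | c p.1 = c p.2} = ∑ b : α, #{i | c i = b} ^ 2 := by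
    rw [Finset.card_eq_sum_card_fiberwise (t := (univ : Finset α)) (f := fun p => c p.1) (by simp)]
    refine Finset.sum_congr rfl fun b _ => ?_
    rw [sq, ← Finset.card_product]
    congr 1
    ext p
    simp only [mem_filter, mem_univ, true_and, mem_product]
    grind
  rw [h1, h2]
  simpa using sq_sum_le_card_mul_sum_sq (s := (univ : Finset α)) (f := fun b => #{i | c i = b})

open Finset in
/-- At most `i / q + (n - 1 - i) / q` of the other indices below `n` are congruent to `i`
modulo `q`. -/
theorem card_filter_ne_and_dvd_sub_le {n : ℕ} (q : ℕ) (i : Fin n) :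
    #{j : Fin n | i ≠ j ∧ (q : ℤ) ∣ (i : ℤ) - j} ≤ (i : ℕ) / q + (n - 1 - i) / q := by
  rw [← Nat.Ioc_filter_dvd_card_eq_div (i : ℕ) q, ← Nat.Ioc_filter_dvd_card_eq_div (n - 1 - i) q,
    ← Finset.card_filter_add_card_filter_not (fun j : Fin n => j < i)]
  refine add_le_add ?_ ?_
  · refine Finset.card_le_card_of_injOn (fun j => (i : ℕ) - j) ?_ ?_
    · intro j hj
      simp only [coe_filter, mem_filter, mem_univ, true_and, Set.mem_ofPred_eq, mem_Ioc] at hj ⊢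
      obtain ⟨⟨_, hd⟩, hlt⟩ := hj
      have : (j : ℕ) < i := hlt
      refine ⟨⟨by omega, by omega⟩, ?_⟩
      rw [← Int.natCast_dvd_natCast, Nat.cast_sub this.le]
      exact hd
    · intro j hj l hl h
      simp only [coe_filter, mem_filter, mem_univ, true_and, Set.mem_ofPred_eq] at hj hl h
      have h1 : (j : ℕ) < i := hj.2
      have h2 : (l : ℕ) < i := hl.2
      exact Fin.ext (by omega)
  · refine Finset.card_le_card_of_injOn (fun j => (j : ℕ) - i) ?_ ?_
    · intro j hj
      simp only [coe_filter, mem_filter, mem_univ, true_and, Set.mem_ofPred_eq, mem_Ioc,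
        not_lt] at hj ⊢
      obtain ⟨⟨hne, hd⟩, hle⟩ := hj
      have : (i : ℕ) < j := lt_of_le_of_ne hle fun h => hne (Fin.ext h)
      refine ⟨⟨by omega, by omega⟩, ?_⟩
      rw [← Int.natCast_dvd_natCast, Nat.cast_sub this.le, ← dvd_neg, neg_sub]
      exact hd
    · intro j hj l hl h
      simp only [coe_filter, mem_filter, mem_univ, true_and, Set.mem_ofPred_eq, not_lt] at hj hl h
      have h1 : (i : ℕ) ≤ j := hj.2
      have h2 : (i : ℕ) ≤ l := hl.2
      exact Fin.ext (by omega)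

section DigitExpansions

variable {F : Type*} [NormedField F]

/-- The first `k` digits of a point of the unit ball determine it up to `r ^ k`. -/
theorem exists_digits (hna : ∀ x y : F, ‖x + y‖ ≤ max ‖x‖ ‖y‖) {r : ℝ} (hr0 : 0 < r) (hr1 : r < 1)
    {π : F} (hπ : ‖π‖ = r) (hval : ∀ x : F, x ≠ 0 → ∃ m : ℤ, ‖x‖ = r ^ m) {T : Finset F}
    (hT : ∀ x : F, ‖x‖ ≤ 1 → ∃ t ∈ T, ‖x - t‖ < 1) (k : ℕ) :
    ∃ c : F → (Fin k → T), ∀ x y : F, ‖x‖ ≤ 1 → ‖y‖ ≤ 1 → c x = c y → ‖x - y‖ ≤ r ^ k := by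
  have hπ0 : π ≠ 0 := norm_pos_iff.1 (hπ ▸ hr0)
  have hlt : ∀ x : F, ‖x‖ < 1 → ‖x / π‖ ≤ 1 := by
    intro x hx
    rw [norm_div, hπ, div_le_one hr0]
    rcases eq_or_ne x 0 with rfl | hx0
    · simpa using hr0.le
    obtain ⟨m, hm⟩ := hval x hx0
    rw [hm] at hx ⊢
    have : 0 < m := by
      by_contra! h
      exact absurd hx (not_lt.2 (one_le_zpow_of_nonpos₀ hr0 hr1.le h))
    simpa using zpow_le_zpow_right_of_le_one₀ hr0 hr1.le (show (1 : ℤ) ≤ m by omega)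
  have hd : ∃ d : F → T, ∀ x, ‖x‖ ≤ 1 → ‖x - d x‖ < 1 := by
    obtain ⟨t₀, ht₀, -⟩ := hT 0 (by simp)
    have : ∀ x : F, ∃ t : T, ‖x‖ ≤ 1 → ‖x - t‖ < 1 := by
      intro x
      by_cases hx : ‖x‖ ≤ 1
      · obtain ⟨t, ht, h⟩ := hT x hx
        exact ⟨⟨t, ht⟩, fun _ => h⟩
      · exact ⟨⟨t₀, ht₀⟩, fun h => absurd h hx⟩
    exact ⟨fun x => (this x).choose, fun x => (this x).choose_spec⟩
  obtain ⟨d, hd⟩ := hd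
  induction k with
  | zero =>
    refine ⟨fun _ => Fin.elim0, fun x y hx hy _ => ?_⟩
    rw [sub_eq_add_neg, pow_zero]
    exact (hna x (-y)).trans (max_le hx (by rwa [norm_neg]))
  | succ k ih =>
    obtain ⟨c, hc⟩ := ih
    refine ⟨fun x => Fin.cons (d x) (c ((x - d x) / π)), fun x y hx hy h => ?_⟩
    obtain ⟨h1, h2⟩ := Fin.cons_inj.1 h
    have h3 := hc _ _ (hlt _ (hd x hx)) (hlt _ (hd y hy)) h2
    rw [← h1, ← sub_div, sub_sub_sub_cancel_right, norm_div, hπ, div_le_iff₀ hr0] at h3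
    rwa [pow_succ]

/-- There are points of the unit ball indexed by `i < Q ^ K` for which `‖z i - z j‖` is bounded
below in terms of the divisibility of `i - j` by powers of `Q`. -/
theorem exists_pow_le_norm_sub (hna : ∀ x y : F, ‖x + y‖ ≤ max ‖x‖ ‖y‖) {r : ℝ} (hr0 : 0 < r)
    (hr1 : r < 1) {π : F} (hπ : ‖π‖ = r) {Q : ℕ} (hQ : 1 < Q) (t : ℕ → F)
    (ht : ∀ a < Q, ‖t a‖ ≤ 1) (hsep : ∀ a < Q, ∀ b < Q, a ≠ b → 1 ≤ ‖t a - t b‖) (K : ℕ) :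
    ∃ z : ℕ → F, (∀ i, ‖z i‖ ≤ 1) ∧ ∀ i < Q ^ K, ∀ j < Q ^ K, i ≠ j →
      ∃ v : ℕ, r ^ v ≤ ‖z i - z j‖ ∧ ((Q ^ v : ℕ) : ℤ) ∣ (i : ℤ) - j := by
  induction K with
  | zero => exact ⟨fun _ => 0, by simp, fun i hi j hj h => by simp at hi hj; omega⟩
  | succ K ih =>
    obtain ⟨z, hz, hzv⟩ := ih
    have hmod : ∀ i, i % Q < Q := fun i => Nat.mod_lt _ (by omega)
    refine ⟨fun i => t (i % Q) + π * z (i / Q), fun i => ?_, fun i hi j hj hij => ?_⟩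
    · refine (hna _ _).trans (max_le (ht _ (hmod i)) ?_)
      rw [norm_mul, hπ]
      exact mul_le_one₀ hr1.le (norm_nonneg _) (hz _)
    by_cases h : i % Q = j % Q
    · have hne : i / Q ≠ j / Q := fun h' => hij (by
        rw [← Nat.div_add_mod i Q, ← Nat.div_add_mod j Q, h, h'])
      rw [pow_succ] at hi hj
      obtain ⟨v, hv, hdvd⟩ := hzv _ (Nat.div_lt_of_lt_mul (by rwa [mul_comm])) _
        (Nat.div_lt_of_lt_mul (by rwa [mul_comm])) hne
      refine ⟨v + 1, ?_, ?_⟩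
      · beta_reduce
        rw [h, add_sub_add_left_eq_sub, ← mul_sub, norm_mul, hπ, pow_succ']
        gcongr
      · have hsub : (i : ℤ) - j = ((i / Q : ℕ) - (j / Q : ℕ)) * Q := by
          have h1 : (Q : ℤ) * (i / Q : ℕ) + (i % Q : ℕ) = i := mod_cast Nat.div_add_mod i Q
          have h2 : (Q : ℤ) * (j / Q : ℕ) + (j % Q : ℕ) = j := mod_cast Nat.div_add_mod j Q
          rw [h] at h1
          linear_combination h2 - h1
        rw [hsub, pow_succ, Nat.cast_mul]
        exact mul_dvd_mul_right hdvd _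
    · refine ⟨0, ?_, by simp⟩
      have h1 := hsep _ (hmod i) _ (hmod j) h
      have h2 : ‖π * (z (j / Q) - z (i / Q))‖ < 1 := by
        rw [norm_mul, hπ]
        refine (mul_le_of_le_one_right hr0.le ?_).trans_lt hr1
        rw [sub_eq_add_neg]
        exact (hna _ _).trans (max_le (hz _) (by rw [norm_neg]; exact hz _))
      by_contra! hlt
      rw [pow_zero] at hlt
      refine absurd h1 (not_le.2 (lt_of_le_of_lt ?_ (max_lt hlt h2)))
      refine le_of_eq_of_le ?_ (hna _ _)
      congr 1
      ring

open Finset in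
/-- In the unit ball, the product of the pairwise distances of `n` points is small. -/
theorem prod_norm_sub_le (hna : ∀ x y : F, ‖x + y‖ ≤ max ‖x‖ ‖y‖) {r : ℝ} (hr0 : 0 < r)
    (hr1 : r < 1) {π : F} (hπ : ‖π‖ = r) (hval : ∀ x : F, x ≠ 0 → ∃ m : ℤ, ‖x‖ = r ^ m)
    {T : Finset F} (hT : ∀ x : F, ‖x‖ ≤ 1 → ∃ t ∈ T, ‖x - t‖ < 1) (hT0 : T.Nonempty)
    (K : ℕ) {n : ℕ} (z : Fin n → F) (hz : ∀ i, ‖z i‖ ≤ 1) :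
    ∏ ij ∈ univ.filter (fun ij : Fin n × Fin n => ij.1 ≠ ij.2), ‖z ij.1 - z ij.2‖ ≤
      r ^ (∑ k ∈ range K, ((n : ℝ) ^ 2 / (T.card : ℝ) ^ (k + 1) - n)) := by
  classical
  have hz1 : ∀ i j, ‖z i - z j‖ ≤ 1 := fun i j => by
    rw [sub_eq_add_neg]
    exact (hna _ _).trans (max_le (hz i) (by rw [norm_neg]; exact hz j))
  have hind : ∀ (x : ℝ), x ≤ 1 → ∀ K : ℕ, x ≤ r ^ #{k ∈ range K | x ≤ r ^ (k + 1)} := by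
    intro x hx K
    induction K with
    | zero => simpa using hx
    | succ K ih =>
      rw [range_add_one, filter_insert]
      split_ifs with h
      · refine h.trans (pow_le_pow_of_le_one hr0.le hr1.le ?_)
        refine (card_insert_le _ _).trans (Nat.succ_le_succ ?_)
        exact (card_filter_le _ _).trans (by simp)
      · exact ih
  set P := univ.filter (fun ij : Fin n × Fin n => ij.1 ≠ ij.2)
  have hcard : ∀ k, (n : ℝ) ^ 2 / (T.card : ℝ) ^ (k + 1) - n ≤
      (#{p ∈ P | ‖z p.1 - z p.2‖ ≤ r ^ (k + 1)} : ℝ) := by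
    intro k
    obtain ⟨c, hc⟩ := exists_digits hna hr0 hr1 hπ hval hT (k + 1)
    have h1 := sq_card_le_card_mul_card_filter_eq (fun i => c (z i))
    simp only [Fintype.card_fin, Fintype.card_fun, Fintype.card_coe] at h1
    have h2 : #{p : Fin n × Fin n | c (z p.1) = c (z p.2)} ≤
        #{p ∈ P | ‖z p.1 - z p.2‖ ≤ r ^ (k + 1)} + n := by
      refine (card_le_card (t := {p ∈ P | ‖z p.1 - z p.2‖ ≤ r ^ (k + 1)} ∪
        univ.image (fun i : Fin n => (i, i))) ?_).trans
          ((card_union_le _ _).trans (Nat.add_le_add_left (card_image_le.trans (by simp)) _))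
      rintro ⟨i, j⟩ hp
      simp only [mem_filter, mem_univ, true_and] at hp
      rcases eq_or_ne i j with rfl | hij
      · simp
      · exact mem_union_left _ (by simp [P, hij, hc _ _ (hz i) (hz j) hp])
    have hpos : (0 : ℝ) < (T.card : ℝ) ^ (k + 1) := pow_pos (mod_cast hT0.card_pos) _
    rw [sub_le_iff_le_add, div_le_iff₀ hpos, mul_comm]
    exact_mod_cast h1.trans (Nat.mul_le_mul_left _ h2)
  calc ∏ ij ∈ P, ‖z ij.1 - z ij.2‖
      ≤ ∏ ij ∈ P, r ^ #{k ∈ range K | ‖z ij.1 - z ij.2‖ ≤ r ^ (k + 1)} :=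
        prod_le_prod (fun _ _ => norm_nonneg _) fun p _ => hind _ (hz1 _ _) K
    _ = r ^ ((∑ k ∈ range K, #{p ∈ P | ‖z p.1 - z p.2‖ ≤ r ^ (k + 1)} : ℕ) : ℝ) := by
        rw [prod_pow_eq_pow_sum, Real.rpow_natCast]
        congr 1
        exact sum_card_bipartiteAbove_eq_sum_card_bipartiteBelow
          (fun (p : Fin n × Fin n) k => ‖z p.1 - z p.2‖ ≤ r ^ (k + 1))
    _ ≤ _ := by
        refine Real.rpow_le_rpow_of_exponent_ge hr0 hr1.le ?_
        push_cast
        exact sum_le_sum fun k _ => hcard k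

open Finset in
/-- The unit ball contains `n` points whose product of pairwise distances is large. -/
theorem exists_pow_le_prod_norm_sub (hna : ∀ x y : F, ‖x + y‖ ≤ max ‖x‖ ‖y‖) {r : ℝ}
    (hr0 : 0 < r) (hr1 : r < 1) {π : F} (hπ : ‖π‖ = r) {Q : ℕ} (hQ : 1 < Q) (t : ℕ → F)
    (ht : ∀ a < Q, ‖t a‖ ≤ 1) (hsep : ∀ a < Q, ∀ b < Q, a ≠ b → 1 ≤ ‖t a - t b‖) (n : ℕ) :
    ∃ z : Fin n → F, (∀ i, ‖z i‖ ≤ 1) ∧ r ^ ((n : ℝ) * (n - 1) / (Q - 1)) ≤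
      ∏ ij ∈ univ.filter (fun ij : Fin n × Fin n => ij.1 ≠ ij.2), ‖z ij.1 - z ij.2‖ := by
  obtain ⟨z, hz, hzv⟩ := exists_pow_le_norm_sub hna hr0 hr1 hπ hQ t ht hsep n
  refine ⟨fun i => z i, fun i => hz i, ?_⟩
  have hnQ : n < Q ^ n := Nat.lt_pow_self hQ
  have hQ' : (0 : ℝ) < (Q : ℝ) - 1 := by
    rw [sub_pos]
    exact_mod_cast hQ
  set P := univ.filter (fun ij : Fin n × Fin n => ij.1 ≠ ij.2)
  have hpair : ∀ p ∈ P, r ^ #{k ∈ Ico 1 n | ((Q ^ k : ℕ) : ℤ) ∣ (p.1 : ℤ) - p.2} ≤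
      ‖z p.1 - z p.2‖ := by
    rintro ⟨i, j⟩ hp
    have hij : (i : ℕ) ≠ j := fun h => (mem_filter.1 hp).2 (Fin.ext h)
    obtain ⟨v, hv, hdvd⟩ := hzv i (i.2.trans hnQ) j (j.2.trans hnQ) hij
    refine le_trans (pow_le_pow_of_le_one hr0.le hr1.le ?_) hv
    have hvn : v < n := by
      have h1 : Q ^ v ≤ ((i : ℤ) - j).natAbs :=
        Nat.le_of_dvd (by omega) (by simpa using Int.natAbs_dvd_natAbs.2 hdvd)
      have h2 : v < Q ^ v := Nat.lt_pow_self hQ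
      omega
    calc v = #(Ico 1 (v + 1)) := by simp
      _ ≤ _ := card_le_card fun k hk => by
        rw [mem_Ico] at hk
        rw [mem_filter, mem_Ico]
        refine ⟨⟨hk.1, by omega⟩, dvd_trans ?_ hdvd⟩
        exact_mod_cast pow_dvd_pow Q (by omega : k ≤ v)
  have hrow : ∀ i : Fin n,
      ∑ k ∈ Ico 1 n, #{j : Fin n | i ≠ j ∧ ((Q ^ k : ℕ) : ℤ) ∣ (i : ℤ) - j} ≤
        (n - 1) / (Q - 1) := by
    intro i
    calc _ ≤ ∑ k ∈ Ico 1 n, ((i : ℕ) / Q ^ k + (n - 1 - i) / Q ^ k) :=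
          sum_le_sum fun k _ => card_filter_ne_and_dvd_sub_le _ i
      _ ≤ i / (Q - 1) + (n - 1 - i) / (Q - 1) := by
          rw [sum_add_distrib]
          exact add_le_add (Nat.geom_sum_Ico_le hQ _ _) (Nat.geom_sum_Ico_le hQ _ _)
      _ ≤ _ := by
          refine Nat.div_add_div_le_add_div.trans ?_
          rw [Nat.add_sub_cancel' (by omega)]
  have hsum : ((∑ p ∈ P, #{k ∈ Ico 1 n | ((Q ^ k : ℕ) : ℤ) ∣ (p.1 : ℤ) - p.2} : ℕ) : ℝ) ≤
      (n : ℝ) * (n - 1) / (Q - 1) := by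
    rcases Nat.eq_zero_or_pos n with rfl | hn
    · simp
    have h1 : ∑ p ∈ P, #{k ∈ Ico 1 n | ((Q ^ k : ℕ) : ℤ) ∣ (p.1 : ℤ) - p.2} =
        ∑ i : Fin n, ∑ k ∈ Ico 1 n, #{j : Fin n | i ≠ j ∧ ((Q ^ k : ℕ) : ℤ) ∣ (i : ℤ) - j} := by
      simp only [P, card_filter, sum_filter, Fintype.sum_prod_type]
      refine sum_congr rfl fun i _ => ?_
      rw [sum_comm]
      refine sum_congr rfl fun j _ => ?_
      split_ifs with h <;> simp [h]
    have h2 := h1.trans_le (sum_le_sum fun i _ => hrow i)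
    rw [sum_const, card_univ, Fintype.card_fin, smul_eq_mul] at h2
    have h3 : (((n - 1) / (Q - 1) : ℕ) : ℝ) ≤ ((n : ℝ) - 1) / (Q - 1) := by
      refine Nat.cast_div_le.trans ?_
      rw [Nat.cast_sub hn, Nat.cast_sub hQ.le, Nat.cast_one]
    calc _ ≤ ((n * ((n - 1) / (Q - 1)) : ℕ) : ℝ) := by exact_mod_cast h2
      _ ≤ (n : ℝ) * (((n : ℝ) - 1) / (Q - 1)) := by
        rw [Nat.cast_mul]
        gcongr
      _ = _ := (mul_div_assoc _ _ _).symm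
  calc _ ≤ r ^ ((∑ p ∈ P, #{k ∈ Ico 1 n | ((Q ^ k : ℕ) : ℤ) ∣ (p.1 : ℤ) - p.2} : ℕ) : ℝ) :=
        Real.rpow_le_rpow_of_exponent_ge hr0 hr1.le hsum
    _ = ∏ p ∈ P, r ^ #{k ∈ Ico 1 n | ((Q ^ k : ℕ) : ℤ) ∣ (p.1 : ℤ) - p.2} := by
        rw [Real.rpow_natCast, prod_pow_eq_pow_sum]
    _ ≤ _ := prod_le_prod (fun _ _ => pow_nonneg hr0.le _) hpair

end DigitExpansions

open Filter Topology in
/-- The exponents in the upper bound for the diameters converge. -/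
theorem tendsto_sum_sq_div_pow_sub_mul_inv (Q : ℝ) (K : ℕ) :
    Tendsto (fun n : ℕ => (∑ k ∈ Finset.range K, ((n : ℝ) ^ 2 / Q ^ (k + 1) - n)) *
      ((n : ℝ) * (n - 1))⁻¹) atTop (𝓝 (∑ k ∈ Finset.range K, (Q ^ (k + 1))⁻¹)) := by
  simp only [Finset.sum_mul]
  refine tendsto_finsetSum _ fun k _ => ?_
  set c := (Q ^ (k + 1))⁻¹
  have h : Tendsto (fun n : ℕ => c + (c - 1) * ((n : ℝ) - 1)⁻¹) atTop (𝓝 (c + (c - 1) * 0)) :=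
    ((tendsto_inv_atTop_zero.comp (tendsto_atTop_add_const_right _ (-1)
      tendsto_natCast_atTop_atTop)).const_mul _).const_add _
  rw [mul_zero, add_zero] at h
  refine h.congr' ?_
  filter_upwards [eventually_ge_atTop 2] with n hn
  have h2 : (2 : ℝ) ≤ n := mod_cast hn
  have h0 : (n : ℝ) ≠ 0 := by linarith
  have h1 : (n : ℝ) - 1 ≠ 0 := by linarith
  rw [div_eq_mul_inv]
  change _ = ((n : ℝ) ^ 2 * c - n) * _
  field_simp
  ring

open Filter Topology in
/-- The sum of the series `∑ Q ^ (-k)` over `k ≥ 1`. -/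
theorem tendsto_sum_inv_pow_succ {Q : ℝ} (hQ : 1 < Q) :
    Tendsto (fun K => ∑ k ∈ Finset.range K, (Q ^ (k + 1))⁻¹) atTop (𝓝 (1 / (Q - 1))) := by
  have h := (hasSum_geometric_of_lt_one (inv_nonneg.2 (by linarith : (0 : ℝ) ≤ Q))
    (inv_lt_one_of_one_lt₀ hQ)).mul_left Q⁻¹
  have h1 : Q - 1 ≠ 0 := by linarith
  have h0 : Q ≠ 0 := by linarith
  have h2 : Q⁻¹ * (1 - Q⁻¹)⁻¹ = 1 / (Q - 1) := by
    field_simp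
  rw [h2] at h
  refine h.tendsto_sum_nat.congr fun K => Finset.sum_congr rfl fun k _ => ?_
  rw [← inv_pow, pow_succ']


/-- The `n`-th diameter of a subset `E` of a nonarchimedean field (sup over `n`-tuples of
points of `E` of the product of pairwise distances over ordered pairs, taken to the power
`1/(n(n-1))`). -/
noncomputable def dn {F : Type*} [NormedField F] (E : Set F) (n : ℕ) : ℝ :=
  sSup {x : ℝ | ∃ z : Fin n → F, (∀ i, z i ∈ E) ∧
    x = (∏ ij ∈ Finset.univ.filter (fun ij : Fin n × Fin n => ij.1 ≠ ij.2),
      ‖z ij.1 - z ij.2‖) ^ (((n : ℝ) * (n - 1))⁻¹)}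

/-- Let `O = {x : ‖x‖ ≤ 1}` be the ring of integers of a nonarchimedean local field `F`
with residue field of order `Q` and uniformizer `π` of absolute value `r = ‖π‖ ∈ (0,1)`
(the value group of `F` being `r^ℤ`, and `O` a disjoint union of `Q` open balls of
radius `1`). Then the transfinite diameter of `O` equals `r^{1/(Q-1)}`:
`lim_n d_n(O) = ‖π‖^{1/(Q-1)}`. -/
theorem statement15 {F : Type*} [NormedField F]
    (hna : ∀ x y : F, ‖x + y‖ ≤ max ‖x‖ ‖y‖)
    (r : ℝ) (hr0 : 0 < r) (hr1 : r < 1)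
    (π : F) (hπ : ‖π‖ = r)
    (hval : ∀ x : F, x ≠ 0 → ∃ m : ℤ, ‖x‖ = r ^ m)
    (Q : ℕ) (hQ : 1 < Q)
    (hres : ∃ T : Finset F, T.card = Q ∧ (∀ t ∈ T, ‖t‖ ≤ 1) ∧
      ∀ x : F, ‖x‖ ≤ 1 → ∃! t, t ∈ T ∧ ‖x - t‖ < 1) :
    Filter.Tendsto (fun n => dn {x : F | ‖x‖ ≤ 1} n) Filter.atTop
      (nhds (r ^ ((1 : ℝ) / ((Q : ℝ) - 1)))) := by
  obtain ⟨T, hTcard, hT1, hTu⟩ := hres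
  have hT : ∀ x : F, ‖x‖ ≤ 1 → ∃ t ∈ T, ‖x - t‖ < 1 := fun x hx => (hTu x hx).exists
  have hT0 : T.Nonempty := Finset.card_pos.1 (by omega)
  have hQ1 : (1 : ℝ) < Q := mod_cast hQ
  have hexp : ∀ n : ℕ, 2 ≤ n → 0 < ((n : ℝ) * (n - 1))⁻¹ := fun n hn => by
    have : (2 : ℝ) ≤ n := mod_cast hn
    exact inv_pos.2 (mul_pos (by linarith) (by linarith))
  let e := T.equivFinOfCardEq hTcard
  let t : ℕ → F := fun a => if h : a < Q then e.symm ⟨a, h⟩ else 0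
  have htmem : ∀ a < Q, t a ∈ T := fun a ha => by simp [t, ha]
  have hsep : ∀ a < Q, ∀ b < Q, a ≠ b → 1 ≤ ‖t a - t b‖ := by
    intro a ha b hb hab
    by_contra! hlt
    have h : t a = t b := (hTu (t a) (hT1 _ (htmem a ha))).unique
      ⟨htmem a ha, by simp⟩ ⟨htmem b hb, hlt⟩
    simp only [t, ha, hb, dif_pos, SetLike.coe_eq_coe, EmbeddingLike.apply_eq_iff_eq] at h
    exact hab (congrArg Fin.val h)
  have hupper : ∀ K n : ℕ, 2 ≤ n → ∀ x ∈ {x : ℝ | ∃ z : Fin n → F,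
      (∀ i, z i ∈ {x : F | ‖x‖ ≤ 1}) ∧
      x = (∏ ij ∈ Finset.univ.filter (fun ij : Fin n × Fin n => ij.1 ≠ ij.2),
        ‖z ij.1 - z ij.2‖) ^ (((n : ℝ) * (n - 1))⁻¹)},
      x ≤ r ^ ((∑ k ∈ Finset.range K, ((n : ℝ) ^ 2 / (Q : ℝ) ^ (k + 1) - n)) *
        ((n : ℝ) * (n - 1))⁻¹) := by
    rintro K n hn _ ⟨z, hz, rfl⟩
    rw [Real.rpow_mul hr0.le, ← hTcard]
    exact Real.rpow_le_rpow (Finset.prod_nonneg fun _ _ => norm_nonneg _)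
      (prod_norm_sub_le hna hr0 hr1 hπ hval hT hT0 K z hz) (hexp n hn).le
  refine tendsto_order.2 ⟨fun a ha => ?_, fun a ha => ?_⟩
  · filter_upwards [Filter.eventually_ge_atTop 2] with n hn
    obtain ⟨z, hz, hle⟩ := exists_pow_le_prod_norm_sub hna hr0 hr1 hπ hQ t
      (fun a ha => hT1 _ (htmem a ha)) hsep n
    refine ha.trans_le (le_trans ?_ (le_csSup ⟨_, hupper 0 n hn⟩ ⟨z, hz, rfl⟩))
    refine le_trans (le_of_eq ?_) (Real.rpow_le_rpow (Real.rpow_nonneg hr0.le _) hle (hexp n hn).le)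
    rw [← Real.rpow_mul hr0.le]
    congr 1
    rw [div_mul_eq_mul_div, mul_inv_cancel₀ (inv_pos.1 (hexp n hn)).ne']
  · have hcont : Continuous fun y : ℝ => r ^ y := Real.continuous_const_rpow hr0.ne'
    obtain ⟨K, hK⟩ := (((hcont.tendsto _).comp (tendsto_sum_inv_pow_succ hQ1)).eventually_lt_const
      ha).exists
    filter_upwards [Filter.eventually_ge_atTop 2,
      ((hcont.tendsto _).comp (tendsto_sum_sq_div_pow_sub_mul_inv (Q : ℝ) K)).eventually_lt_const
        hK] with n hn hlt
    refine lt_of_le_of_lt (csSup_le ?_ (hupper K n hn)) hlt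
    exact ⟨_, fun _ => 0, by simp, rfl⟩
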